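/- arXiv:1107.1270 — 2 statements merged into one kernel-verified Lean document; each statement's English description precedes it below -/
import Mathlib

section
/- Let R and R' be real p×p matrices such that |R'(i,j)| ≤ |R(i,j)| for all i,j, and suppose α := ‖R̄‖ < 1, where R̄ denotes the entrywise absolute value of R. Fix indices i,j and γ ∈ ℕ, and assume (R^k)(i,j) = ((R')^k)(i,j) for all 0 ≤ k ≤ γ (i.e., R' agrees with R on all walks of length at most γ between i and j). Then I−R and I−R' are invertible and |((I−R)^{-1})(i,j) − ((I−R')^{-1})(i,j)| ≤ α^γ · 2α/(1−α). -/
/-- The spectral norm (operator 2-norm) of a real matrix, viewed as a linear map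
between Euclidean spaces. -/
noncomputable def spec {m n : Type*} [Fintype m] [Fintype n] [DecidableEq n]
    (A : Matrix m n ℝ) : ℝ :=
  ‖LinearMap.toContinuousLinearMap
    ((Matrix.toLin (PiLp.basisFun 2 ℝ n) (PiLp.basisFun 2 ℝ m)) A)‖

section

open scoped Matrix.Norms.L2Operator

theorem spec_eq_l2_opNorm {m n : Type*} [Fintype m] [Fintype n] [DecidableEq n]
    (A : Matrix m n ℝ) : spec A = ‖A‖ := by
  rw [Matrix.l2_opNorm_def, spec]
  rfl

theorem l2_opNorm_le_of_abs_le {m n : Type*} [Fintype m] [Fintype n] [DecidableEq n]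
    {A B : Matrix m n ℝ} (h : ∀ i j, |A i j| ≤ B i j) : ‖A‖ ≤ ‖B‖ := by
  rw [Matrix.l2_opNorm_def A]
  refine ContinuousLinearMap.opNorm_le_bound _ (norm_nonneg _) fun x => ?_
  set y : EuclideanSpace ℝ n := WithLp.toLp 2 fun j => |x j|
  have hy : ‖y‖ = ‖x‖ := by simp [y, EuclideanSpace.norm_eq]
  have hB := Matrix.l2_opNorm_mulVec B y
  rw [hy] at hB
  refine le_trans ?_ hB
  rw [EuclideanSpace.norm_eq, EuclideanSpace.norm_eq]
  refine Real.sqrt_le_sqrt (Finset.sum_le_sum fun i _ => ?_)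
  refine pow_le_pow_left₀ (norm_nonneg _) ?_ 2
  change |∑ j, A i j * x j| ≤ |∑ j, B i j * (|x j|)|
  refine le_trans ?_ (le_abs_self _)
  refine (Finset.abs_sum_le_sum_abs _ _).trans (Finset.sum_le_sum fun j _ => ?_)
  rw [abs_mul]
  exact mul_le_mul_of_nonneg_right (h i j) (abs_nonneg _)

theorem abs_entry_le_l2_opNorm {m n : Type*} [Fintype m] [Fintype n] [DecidableEq n]
    (A : Matrix m n ℝ) (i : m) (j : n) : |A i j| ≤ ‖A‖ := by
  have h := Matrix.l2_opNorm_mulVec A (EuclideanSpace.single j 1)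
  rw [PiLp.norm_single, norm_one, mul_one] at h
  refine le_trans ?_ h
  refine le_trans (le_of_eq ?_) (PiLp.norm_apply_le _ i)
  simp

theorem isUnit_one_sub_of_l2_opNorm_lt_one {n : Type*} [Fintype n] [DecidableEq n]
    {A : Matrix n n ℝ} (h : ‖A‖ < 1) : IsUnit (1 - A) :=
  isUnit_one_sub_of_norm_lt_one h

theorem hasSum_pow_entry_inv_one_sub {n : Type*} [Fintype n] [DecidableEq n]
    {A : Matrix n n ℝ} (h : ‖A‖ < 1) (i j : n) :
    HasSum (fun k : ℕ => (A ^ k) i j) ((1 - A)⁻¹ i j) := by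
  have hs := hasSum_geom_series_inverse A h
  rw [← Matrix.nonsing_inv_eq_ringInverse] at hs
  exact Pi.hasSum.1 (Pi.hasSum.1 hs i) j

theorem abs_inv_one_sub_entry_sub_le {n : Type*} [Fintype n] [DecidableEq n]
    {A B : Matrix n n ℝ} {α : ℝ} (hA : ‖A‖ ≤ α) (hB : ‖B‖ ≤ α) (hα : α < 1) (i j : n) (γ : ℕ)
    (hagree : ∀ k ≤ γ, (A ^ k) i j = (B ^ k) i j) :
    |(1 - A)⁻¹ i j - (1 - B)⁻¹ i j| ≤ α ^ γ * (2 * α / (1 - α)) := by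
  have hα0 : 0 ≤ α := (norm_nonneg A).trans hA
  have hpow {C : Matrix n n ℝ} (hC : ‖C‖ ≤ α) (k : ℕ) :
      |(C ^ (k + (γ + 1))) i j| ≤ α ^ (k + (γ + 1)) :=
    (abs_entry_le_l2_opNorm _ i j).trans <| (norm_pow_le' C (by omega)).trans <|
      pow_le_pow_left₀ (norm_nonneg _) hC _
  have hs := (hasSum_pow_entry_inv_one_sub (hA.trans_lt hα) i j).sub
    (hasSum_pow_entry_inv_one_sub (hB.trans_lt hα) i j)
  rw [← hasSum_nat_add_iff' (γ + 1), Finset.sum_eq_zero, sub_zero] at hs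
  · have hg := (hasSum_geometric_of_lt_one hα0 hα).mul_left (2 * α ^ (γ + 1))
    have hbound := hs.norm_le_of_bounded hg fun k => ?_
    · rw [Real.norm_eq_abs] at hbound
      refine hbound.trans_eq ?_
      rw [pow_succ, div_eq_mul_inv]
      ring
    · calc ‖(A ^ (k + (γ + 1))) i j - (B ^ (k + (γ + 1))) i j‖
          ≤ |(A ^ (k + (γ + 1))) i j| + |(B ^ (k + (γ + 1))) i j| := norm_sub_le _ _
        _ ≤ α ^ (k + (γ + 1)) + α ^ (k + (γ + 1)) := add_le_add (hpow hA k) (hpow hB k)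
        _ = 2 * α ^ (γ + 1) * α ^ k := by ring
  · intro k hk
    rw [hagree k (Nat.lt_succ_iff.1 (Finset.mem_range.1 hk)), sub_self]

theorem l2_opNorm_le_of_spec_abs {m n : Type*} [Fintype m] [Fintype n] [DecidableEq n]
    {A B : Matrix m n ℝ} {α : ℝ} (h : ∀ i j, |A i j| ≤ |B i j|)
    (hα : spec (Matrix.of fun i j => |B i j|) = α) : ‖A‖ ≤ α := by
  rw [← hα, spec_eq_l2_opNorm]
  exact l2_opNorm_le_of_abs_le h

end

/-- **Covariance perturbation bound under walk-summability.**  If `R'` is entrywise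
dominated in absolute value by `R`, the entrywise absolute value `R̄` of `R` has spectral
norm `α < 1`, and the powers of `R` and `R'` agree at the entry `(i,j)` up to power `γ`,
then `|((I-R)⁻¹)(i,j) - ((I-R')⁻¹)(i,j)| ≤ α^γ · 2α/(1-α)`. -/
theorem stmt_1 {p : ℕ} (R R' : Matrix (Fin p) (Fin p) ℝ) (α : ℝ)
    (hdom : ∀ i j, |R' i j| ≤ |R i j|)
    (hα : spec (Matrix.of fun i j => |R i j|) = α) (hα1 : α < 1)
    (i j : Fin p) (γ : ℕ)
    (hagree : ∀ k ≤ γ, (R ^ k) i j = (R' ^ k) i j) :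
    IsUnit (1 - R) ∧ IsUnit (1 - R') ∧
    |(1 - R)⁻¹ i j - (1 - R')⁻¹ i j| ≤ α ^ γ * (2 * α / (1 - α)) := by
  have hR := l2_opNorm_le_of_spec_abs (fun _ _ => le_rfl) hα
  have hR' := l2_opNorm_le_of_spec_abs hdom hα
  exact ⟨isUnit_one_sub_of_l2_opNorm_lt_one (hR.trans_lt hα1),
    isUnit_one_sub_of_l2_opNorm_lt_one (hR'.trans_lt hα1),
    abs_inv_one_sub_entry_sub_le hR hR' hα1 i j γ hagree⟩
end

section
/- Let R be a symmetric real p×p matrix with zero diagonal such that ‖R̄‖ ≤ α < 1, where R̄ is the entrywise absolute value of R. For any subset S of indices, the principal submatrix of J = I − R obtained by deleting the rows and columns in S is positive definite, and every diagonal entry of its inverse is at most (1−α)^{-1}. In particular, for a walk-summable Gaussian graphical model with precision matrix J = I − R, the conditional variance satisfies Σ(i,i|S) ≤ (1−α)^{-1} for every i ∉ S. -/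
theorem dotProduct_mulVec_le_spec {n : Type*} [Fintype n] [DecidableEq n]
    (A : Matrix n n ℝ) (x : n → ℝ) : x ⬝ᵥ A.mulVec x ≤ spec A * (x ⬝ᵥ x) := by
  have hop := (LinearMap.toContinuousLinearMap ((Matrix.toLin (PiLp.basisFun 2 ℝ n)
    (PiLp.basisFun 2 ℝ n)) A)).le_opNorm (WithLp.toLp 2 x)
  have hA : (LinearMap.toContinuousLinearMap ((Matrix.toLin (PiLp.basisFun 2 ℝ n)
      (PiLp.basisFun 2 ℝ n)) A)) (WithLp.toLp 2 x) = WithLp.toLp 2 (A.mulVec x) := by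
    rw [LinearMap.coe_toContinuousLinearMap', ← Matrix.toLpLin_eq_toLin]
    rfl
  rw [hA] at hop
  have hxx : x ⬝ᵥ x = ‖WithLp.toLp 2 x‖ * ‖WithLp.toLp 2 x‖ := by
    rw [← real_inner_self_eq_norm_mul_norm, EuclideanSpace.inner_toLp_toLp]
    simp
  calc x ⬝ᵥ A.mulVec x = inner ℝ (WithLp.toLp 2 (A.mulVec x)) (WithLp.toLp 2 x) := by
        rw [EuclideanSpace.inner_toLp_toLp]
        simp
    _ ≤ ‖WithLp.toLp 2 (A.mulVec x)‖ * ‖WithLp.toLp 2 x‖ := real_inner_le_norm _ _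
    _ ≤ spec A * ‖WithLp.toLp 2 x‖ * ‖WithLp.toLp 2 x‖ := by
        gcongr
        exact hop
    _ = spec A * (x ⬝ᵥ x) := by rw [hxx]; ring

theorem dotProduct_mulVec_le_abs {n : Type*} [Fintype n] (A : Matrix n n ℝ) (x : n → ℝ) :
    x ⬝ᵥ A.mulVec x ≤ |x| ⬝ᵥ (Matrix.of fun i j => |A i j|).mulVec |x| := by
  simp only [dotProduct, Matrix.mulVec, Finset.mul_sum, Matrix.of_apply, Pi.abs_apply]
  refine Finset.sum_le_sum fun i _ => Finset.sum_le_sum fun j _ => ?_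
  rw [← abs_mul, ← abs_mul]
  exact le_abs_self _

theorem mul_dotProduct_le_one_sub {n : Type*} [Fintype n] [DecidableEq n]
    {R : Matrix n n ℝ} {α : ℝ} (hα : spec (Matrix.of fun i j => |R i j|) ≤ α) (x : n → ℝ) :
    (1 - α) * (x ⬝ᵥ x) ≤ x ⬝ᵥ (1 - R).mulVec x := by
  have habs : |x| ⬝ᵥ |x| = x ⬝ᵥ x := by simp [dotProduct]
  have hnn : 0 ≤ x ⬝ᵥ x := Finset.sum_nonneg fun i _ => mul_self_nonneg (x i)
  have h := (dotProduct_mulVec_le_abs R x).trans (dotProduct_mulVec_le_spec _ |x|)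
  rw [habs] at h
  rw [Matrix.sub_mulVec, Matrix.one_mulVec, dotProduct_sub]
  nlinarith [mul_le_mul_of_nonneg_right hα hnn]

/-- A quadratic lower bound passes to principal submatrices. -/
theorem mul_dotProduct_le_submatrix {n : Type*} [Fintype n] {P : n → Prop}
    [DecidablePred P] {M : Matrix n n ℝ} {c : ℝ}
    (hM : ∀ x : n → ℝ, c * (x ⬝ᵥ x) ≤ x ⬝ᵥ M.mulVec x) (x : {i // P i} → ℝ) :
    c * (x ⬝ᵥ x) ≤
      x ⬝ᵥ (M.submatrix (Subtype.val : {i // P i} → n) Subtype.val).mulVec x := by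
  let y : n → ℝ := fun i => if h : P i then x ⟨i, h⟩ else 0
  have hy (i : {i // P i}) : y i = x i := by simp [y, i.2]
  have hsum (f : n → ℝ) : ∑ i, y i * f i = ∑ i : {i // P i}, x i * f i := by
    rw [← Fintype.sum_subtype_add_sum_subtype P]
    have hz : ∑ i : {i // ¬ P i}, y i * f i = 0 :=
      Finset.sum_eq_zero fun i _ => by simp [y, i.2]
    simp only [hz, add_zero, hy]
  have hyy : y ⬝ᵥ y = x ⬝ᵥ x := by simp only [dotProduct, hsum, hy]
  have hMy : y ⬝ᵥ M.mulVec y =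
      x ⬝ᵥ (M.submatrix (Subtype.val : {i // P i} → n) Subtype.val).mulVec x := by
    simp only [dotProduct, Matrix.mulVec, hsum, mul_comm (M _ _), Matrix.submatrix_apply]
  simpa only [hyy, hMy] using hM y

theorem posDef_of_mul_dotProduct_le {n : Type*} [Fintype n] {M : Matrix n n ℝ}
    (hsym : M.IsSymm) {c : ℝ} (hc : 0 < c)
    (hM : ∀ x : n → ℝ, c * (x ⬝ᵥ x) ≤ x ⬝ᵥ M.mulVec x) : M.PosDef := by
  refine Matrix.PosDef.of_dotProduct_mulVec_pos ?_ fun x hx => ?_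
  · rw [Matrix.IsHermitian, Matrix.conjTranspose_eq_transpose_of_trivial]
    exact hsym
  · rw [star_trivial]
    have hpos : 0 < x ⬝ᵥ x :=
      lt_of_le_of_ne (Finset.sum_nonneg fun i _ => mul_self_nonneg (x i))
        fun h => hx (dotProduct_self_eq_zero.mp h.symm)
    exact (mul_pos hc hpos).trans_le (hM x)

theorem inv_diag_le_of_mul_dotProduct_le {n : Type*} [Fintype n] [DecidableEq n]
    {M : Matrix n n ℝ} (hunit : IsUnit M) {c : ℝ} (hc : 0 < c)
    (hM : ∀ x : n → ℝ, c * (x ⬝ᵥ x) ≤ x ⬝ᵥ M.mulVec x) (i : n) : M⁻¹ i i ≤ c⁻¹ := by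
  have h := hM (M⁻¹.mulVec (Pi.single i 1))
  rw [Matrix.mulVec_mulVec, Matrix.mul_nonsing_inv _ ((Matrix.isUnit_iff_isUnit_det _).mp hunit),
    Matrix.one_mulVec, dotProduct_single_one, Matrix.mulVec_single_one] at h
  have hsq : M⁻¹ i i * M⁻¹ i i ≤ M⁻¹.col i ⬝ᵥ M⁻¹.col i :=
    Finset.single_le_sum (f := fun j => M⁻¹ j i * M⁻¹ j i)
      (fun j _ => mul_self_nonneg _) (Finset.mem_univ i)
  have h' : c * (M⁻¹ i i * M⁻¹ i i) ≤ M⁻¹ i i :=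
    (mul_le_mul_of_nonneg_left hsq hc.le).trans h
  rcases le_or_gt (M⁻¹ i i) 0 with hneg | hpos
  · exact hneg.trans (inv_pos.mpr hc).le
  · rw [le_inv_comm₀ hpos hc, ← one_div, le_div_iff₀ hpos]
    nlinarith

/-- **Conditional variances are bounded under walk-summability.**  If `R` is symmetric with
zero diagonal and `‖R̄‖ ≤ α < 1`, then for every subset `S` of indices, the principal
submatrix of `J = I - R` obtained by deleting the rows and columns in `S` is positive
definite, and every diagonal entry of its inverse (i.e. every conditional variance
`Σ(i,i|S)` of the corresponding Gaussian graphical model) is at most `(1-α)⁻¹`. -/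
theorem stmt_3 {p : ℕ} (R : Matrix (Fin p) (Fin p) ℝ) (hsym : R.IsSymm)
    (hdiag : ∀ i, R i i = 0) (α : ℝ)
    (hα : spec (Matrix.of fun i j => |R i j|) ≤ α) (hα1 : α < 1)
    (S : Finset (Fin p)) :
    (((1 : Matrix (Fin p) (Fin p) ℝ) - R).submatrix
        (Subtype.val : {i : Fin p // i ∉ S} → Fin p) Subtype.val).PosDef ∧
    ∀ i : {i : Fin p // i ∉ S},
      (((1 : Matrix (Fin p) (Fin p) ℝ) - R).submatrix
        (Subtype.val : {i : Fin p // i ∉ S} → Fin p) Subtype.val)⁻¹ i i ≤ (1 - α)⁻¹ := by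
  have hc : 0 < 1 - α := sub_pos.mpr hα1
  have hquad := mul_dotProduct_le_submatrix (P := fun i => i ∉ S) (mul_dotProduct_le_one_sub hα)
  have hpd := posDef_of_mul_dotProduct_le ((Matrix.isSymm_one.sub hsym).submatrix _) hc hquad
  exact ⟨hpd, inv_diag_le_of_mul_dotProduct_le hpd.isUnit hc hquad⟩
end
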